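/- Radial limits of functions in the commutative resolvent algebra exist: let X be a finite-dimensional real inner product space, let f ∈ C_R(X), let v ∈ X with ‖v‖ = 1, and let w ∈ X. Then the limit lim_{t→+∞} f(t·v + w) exists in ℂ. -/

import Mathlib

open Filter Topology
open scoped BoundedContinuousFunction InnerProductSpace

noncomputable section

variable (X : Type*) [NormedAddCommGroup X] [InnerProductSpace ℝ X]

/-- The resolvent functions `h^λ_x : y ↦ 1/(iλ - ⟨x,y⟩)`, as elements of `C_b(X, ℂ)`. -/
def resolventFns : Set (X →ᵇ ℂ) :=
  {f | ∃ (x : X) (l : ℝ), l ≠ 0 ∧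
    ∀ y : X, f y = (Complex.I * (l : ℂ) - ((⟪x, y⟫_ℝ : ℝ) : ℂ))⁻¹}

/-- The commutative resolvent algebra `C_R(X)`. -/
def CR : StarSubalgebra ℂ (X →ᵇ ℂ) :=
  (StarAlgebra.adjoin ℂ (resolventFns X)).topologicalClosure

theorem radial_limit_gen {X : Type*} [NormedAddCommGroup X] [InnerProductSpace ℝ X]
    (f : X →ᵇ ℂ) (hf : f ∈ resolventFns X) (v w : X) :
    ∃ c : ℂ, Tendsto (fun t : ℝ => f (t • v + w)) atTop (𝓝 c) := by
  obtain ⟨x, l, hl, h⟩ := hf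
  simp only [h, inner_add_right, inner_smul_right]
  by_cases ha : ⟪x, v⟫_ℝ = 0
  · simp only [ha, mul_zero]
    exact ⟨_, tendsto_const_nhds⟩
  · refine ⟨0, ?_⟩
    apply tendsto_inv₀_cobounded.comp
    rw [← tendsto_norm_atTop_iff_cobounded]
    have h1 : Tendsto (fun t : ℝ => |t * ⟪x, v⟫_ℝ + ⟪x, w⟫_ℝ|) atTop atTop := by
      rcases lt_or_gt_of_ne ha with h0 | h0
      · exact tendsto_abs_atBot_atTop.comp
          (tendsto_atBot_add_const_right _ _ (tendsto_id.atTop_mul_const_of_neg h0))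
      · exact tendsto_abs_atTop_atTop.comp
          (tendsto_atTop_add_const_right _ _ (tendsto_id.atTop_mul_const h0))
    refine tendsto_atTop_mono (fun t => ?_) h1
    have := Complex.abs_re_le_norm
      (Complex.I * (l : ℂ) - ((t * ⟪x, v⟫_ℝ + ⟪x, w⟫_ℝ : ℝ) : ℂ))
    rw [Complex.sub_re, Complex.ofReal_re] at this
    simpa only [Complex.mul_re, Complex.I_re, Complex.I_im, Complex.ofReal_im, zero_mul, mul_zero,
      sub_zero, zero_sub, abs_neg] using this

theorem radial_limit_adjoin {X : Type*} [NormedAddCommGroup X] [InnerProductSpace ℝ X]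
    (f : X →ᵇ ℂ) (hf : f ∈ StarAlgebra.adjoin ℂ (resolventFns X)) (v w : X) :
    ∃ c : ℂ, Tendsto (fun t : ℝ => f (t • v + w)) atTop (𝓝 c) := by
  induction hf using StarAlgebra.adjoin_induction with
  | mem f h => exact radial_limit_gen f h v w
  | algebraMap r => exact ⟨_, tendsto_const_nhds⟩
  | add f g _ _ hf hg =>
    obtain ⟨a, ha⟩ := hf
    obtain ⟨b, hb⟩ := hg
    exact ⟨a + b, ha.add hb⟩
  | mul f g _ _ hf hg =>
    obtain ⟨a, ha⟩ := hf
    obtain ⟨b, hb⟩ := hg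
    exact ⟨a * b, ha.mul hb⟩
  | star f _ hf =>
    obtain ⟨a, ha⟩ := hf
    exact ⟨star a, ha.star⟩

/-- radial limits of functions in the commutative resolvent algebra exist: for
`X` a finite dimensional real inner product space, `f ∈ C_R(X)`, `v ∈ X` a unit vector and
`w ∈ X`, the limit `lim_{t → +∞} f(t·v + w)` exists in `ℂ`. -/
theorem radial_limit_exists (X : Type*) [NormedAddCommGroup X] [InnerProductSpace ℝ X]
    [FiniteDimensional ℝ X]
    (f : X →ᵇ ℂ) (hf : f ∈ CR X) (v : X) (hv : ‖v‖ = 1) (w : X) :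
    ∃ c : ℂ, Tendsto (fun t : ℝ => f (t • v + w)) atTop (𝓝 c) := by
  have hf' : f ∈ closure (StarAlgebra.adjoin ℂ (resolventFns X) : Set (X →ᵇ ℂ)) := hf
  apply cauchy_map_iff_exists_tendsto.mp
  rw [Metric.cauchy_iff]
  refine ⟨inferInstance, fun ε hε => ?_⟩
  obtain ⟨g, hg, hfg⟩ := Metric.mem_closure_iff.mp hf' (ε / 4) (by positivity)
  obtain ⟨c, hc⟩ := radial_limit_adjoin g hg v w
  have hev := hc.eventually (Metric.ball_mem_nhds c (show 0 < ε / 4 by positivity))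
  refine ⟨_, image_mem_map hev, ?_⟩
  rintro _ ⟨s, hs, rfl⟩ _ ⟨t, ht, rfl⟩
  have key : ∀ t : ℝ, g (t • v + w) ∈ Metric.ball c (ε / 4) →
      dist (f (t • v + w)) c < ε / 2 := by
    intro t ht
    have h1 := BoundedContinuousFunction.dist_coe_le_dist (f := f) (g := g) (t • v + w)
    have h2 := dist_triangle (f (t • v + w)) (g (t • v + w)) c
    rw [Metric.mem_ball] at ht
    linarith
  have h1 := key s hs
  have h2 := key t ht
  have h3 := dist_triangle_right (f (s • v + w)) (f (t • v + w)) c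
  linarith
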